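/- arXiv:2107.14284 — 2 statements merged into one kernel-verified Lean document; each statement's English description precedes it below -/
import Mathlib

section
/- For every partition λ of size n ≥ 1 (i.e., the parts of λ sum to n), the supernorm satisfies p_n ≤ N̂(λ) ≤ 2^n, where p_n is the n-th prime and N̂(λ) = ∏_i p_i^{m_i} with m_i the multiplicity of the part i in λ. -/
/-- The i-th prime (1-indexed): p_1 = 2, p_2 = 3, ... -/
noncomputable def nthPrime (i : ℕ) : ℕ := Nat.nth Nat.Prime (i - 1)

/-- The supernorm of a partition (a multiset of positive integers):
    each part i is replaced by the i-th prime, and the results are multiplied. -/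
noncomputable def supernorm (L : Multiset ℕ) : ℕ := (L.map nthPrime).prod

open Nat in
theorem sn_centralBinom_le (n : ℕ) (n_large : 2 < n) :
    centralBinom n ≤ (2 * n) ^ sqrt (2 * n) * 4 ^ (2 * n / 3) *
      (2 * n) ^ ((Finset.Ioc n (2 * n)).filter Nat.Prime).card := by
  have n_pos : 0 < n := (Nat.zero_le _).trans_lt n_large
  have n2_pos : 1 ≤ 2 * n := mul_pos (zero_lt_two' ℕ) n_pos
  let f : ℕ → ℕ := fun x => x ^ n.centralBinom.factorization x
  let S := {p ∈ Finset.range (2 * n / 3 + 1) | Nat.Prime p}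
  let T := (Finset.Ioc n (2 * n)).filter Nat.Prime
  have hST : Disjoint S T := by
    rw [Finset.disjoint_left]
    intro p hp hq
    simp only [S, T, Finset.mem_filter, Finset.mem_range, Finset.mem_Ioc] at hp hq
    omega
  have hprod : centralBinom n = ∏ p ∈ S ∪ T, f p := by
    refine (Eq.trans ?_ n.prod_pow_factorization_centralBinom).symm
    apply Finset.prod_subset
    · intro p hp
      simp only [S, T, Finset.mem_union, Finset.mem_filter, Finset.mem_range,
        Finset.mem_Ioc] at hp ⊢
      omega
    · intro x hx h2x
      show x ^ n.centralBinom.factorization x = 1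
      by_cases hpx : x.Prime
      · simp only [S, T, Finset.mem_union, Finset.mem_filter, Finset.mem_range,
          Finset.mem_Ioc, hpx, and_true] at hx h2x
        rw [factorization_centralBinom_of_two_mul_self_lt_three_mul n_large (by omega) (by omega),
          Nat.pow_zero]
      · rw [factorization_eq_zero_of_not_prime n.centralBinom hpx, Nat.pow_zero]
  rw [hprod, Finset.prod_union hST]
  apply mul_le_mul'
  · rw [← Finset.prod_filter_mul_prod_filter_not S (· ≤ sqrt (2 * n))]
    apply mul_le_mul'
    · refine (Finset.prod_le_prod' fun p _ => (?_ : f p ≤ 2 * n)).trans ?_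
      · exact pow_factorization_choose_le (mul_pos two_pos n_pos)
      have : (Finset.Icc 1 (sqrt (2 * n))).card = sqrt (2 * n) := by
        rw [card_Icc, Nat.add_sub_cancel]
      rw [Finset.prod_const]
      refine pow_right_mono₀ n2_pos ((Finset.card_le_card fun x hx => ?_).trans this.le)
      obtain ⟨h1, h2⟩ := Finset.mem_filter.1 hx
      exact Finset.mem_Icc.mpr ⟨(Finset.mem_filter.1 h1).2.one_lt.le, h2⟩
    · refine le_trans ?_ (primorial_le_four_pow (2 * n / 3))
      refine (Finset.prod_le_prod' fun p hp => (?_ : f p ≤ p)).trans ?_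
      · obtain ⟨h1, h2⟩ := Finset.mem_filter.1 hp
        refine (pow_right_mono₀ (Finset.mem_filter.1 h1).2.one_lt.le ?_).trans (pow_one p).le
        exact Nat.factorization_choose_le_one (sqrt_lt'.mp <| not_le.1 h2)
      refine Finset.prod_le_prod_of_subset_of_one_le' (Finset.filter_subset _ _) ?_
      exact fun p hp _ => (Finset.mem_filter.1 hp).2.one_lt.le
  · refine (Finset.prod_le_prod' fun p _ => (?_ : f p ≤ 2 * n)).trans ?_
    · exact pow_factorization_choose_le (mul_pos two_pos n_pos)
    rw [Finset.prod_const]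

theorem sn_pow_bound (t : ℕ) (ht : 8 ≤ t) : 32 * t ≤ 2 ^ t := by
  induction t, ht using Nat.le_induction with
  | base => norm_num
  | succ m hm ih => rw [pow_succ]; omega

theorem sn_pi_le (r : ℕ) : Nat.primeCounting r ≤ r / 2 + 1 := by
  rcases lt_or_ge r 2 with h | h
  · have : Nat.primeCounting r = 0 := Nat.primeCounting_eq_zero_iff.2 (by omega)
    omega
  · obtain ⟨n, rfl⟩ := Nat.exists_eq_add_of_le h
    have h1 := Nat.primeCounting_add_le (a := 2) (k := 2) (by norm_num) le_rfl n
    have h2 : Nat.primeCounting 2 = 1 := by decide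
    rw [h2, Nat.totient_two] at h1
    omega

theorem sn_large (n : ℕ) (hn : 8192 ≤ n) :
    Nat.primeCounting (Nat.sqrt (2 * n + 1)) ≤ ((Finset.Ioc n (2 * n)).filter Nat.Prime).card := by
  by_contra! hlt
  have hcb := sn_centralBinom_le n (by omega)
  have hlow := Nat.four_pow_lt_mul_centralBinom n (by omega)
  set k := ((Finset.Ioc n (2 * n)).filter Nat.Prime).card with hk
  have hpi := sn_pi_le (Nat.sqrt (2 * n + 1))
  set s := Nat.sqrt (2 * n) with hs
  have hs1 : s * s ≤ 2 * n := Nat.sqrt_le _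
  have hs2 : 2 * n < (s + 1) * (s + 1) := Nat.lt_succ_sqrt _
  have hr : Nat.sqrt (2 * n + 1) ≤ s + 1 := Nat.sqrt_succ_le_succ_sqrt _
  have hs128 : 128 ≤ s := Nat.le_sqrt.2 (by omega)
  obtain ⟨t, ht⟩ : ∃ t, t = Nat.size s := ⟨_, rfl⟩
  have ht1 : s < 2 ^ t := ht ▸ Nat.lt_size_self s
  have ht8 : 8 ≤ t := by
    by_contra! h
    have : 2 ^ t ≤ 2 ^ 7 := Nat.pow_le_pow_right (by norm_num) (by omega)
    omega
  have ht2 : 2 ^ (t - 1) ≤ s := Nat.lt_size.1 (by omega)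
  have ht3 : 16 * t ≤ s := by
    have := sn_pow_bound t ht8
    have h2 : 2 ^ t = 2 * 2 ^ (t - 1) := by
      rw [← pow_succ']; congr 1; omega
    omega
  have h2n : 2 * n ≤ 2 ^ (2 * t) := by
    have : (s + 1) * (s + 1) ≤ 2 ^ t * 2 ^ t := Nat.mul_le_mul ht1 ht1
    rw [two_mul t, pow_add]; omega
  have hk2 : 2 * k ≤ s + 1 := by omega
  have hexp : 3 * (t * (s + k + 1)) ≤ n := by
    have : 9 * t * (s + 1) ≤ s * s := by nlinarith
    nlinarith
  have hA : n * Nat.centralBinom n ≤ 2 ^ (2 * t * (s + k + 1)) * 4 ^ (2 * n / 3) := by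
    calc n * Nat.centralBinom n ≤ (2 * n) * ((2 * n) ^ s * 4 ^ (2 * n / 3) * (2 * n) ^ k) :=
          Nat.mul_le_mul (by omega) hcb
      _ = (2 * n) ^ (s + k + 1) * 4 ^ (2 * n / 3) := by ring
      _ ≤ (2 ^ (2 * t)) ^ (s + k + 1) * 4 ^ (2 * n / 3) := by gcongr
      _ = _ := by rw [← pow_mul]
  have hB : 2 ^ (2 * t * (s + k + 1)) * 4 ^ (2 * n / 3) ≤ 4 ^ n := by
    rw [mul_assoc 2 t, pow_mul, show 2 ^ 2 = 4 by norm_num, ← pow_add]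
    apply Nat.pow_le_pow_right (by norm_num)
    omega
  omega

theorem sn_window (A C B k n : ℕ) (hA : A ≤ n) (hB : n ≤ B) (hC : C ≤ 2 * A)
    (h1 : Nat.primeCounting (Nat.sqrt (2 * B + 1)) ≤ k)
    (h2 : k ≤ ((Finset.Ioc B C).filter Nat.Prime).card) :
    Nat.primeCounting (Nat.sqrt (2 * n + 1)) ≤ ((Finset.Ioc n (2 * n)).filter Nat.Prime).card := by
  refine (Nat.monotone_primeCounting (Nat.sqrt_le_sqrt (by omega))).trans (h1.trans (h2.trans ?_))
  apply Finset.card_le_card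
  apply Finset.filter_subset_filter
  apply Finset.Ioc_subset_Ioc <;> omega

theorem sn_of_list (B C : ℕ) (l : List ℕ) (hl : l.Nodup)
    (h : ∀ p ∈ l, (B < p ∧ p ≤ C) ∧ p.Prime) :
    l.length ≤ ((Finset.Ioc B C).filter Nat.Prime).card := by
  rw [← List.toFinset_card_of_nodup hl]
  apply Finset.card_le_card
  intro p hp
  simpa using h p (List.mem_toFinset.1 hp)

theorem sn_count_2 : 1 ≤ ((Finset.Ioc 2 4).filter Nat.Prime).card := by
  refine sn_of_list _ _ [3] (by decide) ?_
  simp only [List.forall_mem_cons]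
  norm_num

theorem sn_root_2 : Nat.primeCounting (Nat.sqrt (2 * 2 + 1)) ≤ 1 := by
  decide +kernel

theorem sn_count_3 : 1 ≤ ((Finset.Ioc 3 6).filter Nat.Prime).card := by
  refine sn_of_list _ _ [5] (by decide) ?_
  simp only [List.forall_mem_cons]
  norm_num

theorem sn_root_3 : Nat.primeCounting (Nat.sqrt (2 * 3 + 1)) ≤ 1 := by
  decide +kernel

theorem sn_count_4 : 2 ≤ ((Finset.Ioc 4 8).filter Nat.Prime).card := by
  refine sn_of_list _ _ [5, 7] (by decide) ?_
  simp only [List.forall_mem_cons]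
  norm_num

theorem sn_root_4 : Nat.primeCounting (Nat.sqrt (2 * 4 + 1)) ≤ 2 := by
  decide +kernel

theorem sn_count_6 : 2 ≤ ((Finset.Ioc 6 12).filter Nat.Prime).card := by
  refine sn_of_list _ _ [7, 11] (by decide) ?_
  simp only [List.forall_mem_cons]
  norm_num

theorem sn_root_6 : Nat.primeCounting (Nat.sqrt (2 * 6 + 1)) ≤ 2 := by
  decide +kernel

theorem sn_count_7 : 2 ≤ ((Finset.Ioc 10 14).filter Nat.Prime).card := by
  refine sn_of_list _ _ [11, 13] (by decide) ?_
  simp only [List.forall_mem_cons]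
  norm_num

theorem sn_root_7 : Nat.primeCounting (Nat.sqrt (2 * 10 + 1)) ≤ 2 := by
  decide +kernel

theorem sn_count_11 : 3 ≤ ((Finset.Ioc 12 22).filter Nat.Prime).card := by
  refine sn_of_list _ _ [13, 17, 19] (by decide) ?_
  simp only [List.forall_mem_cons]
  norm_num

theorem sn_root_11 : Nat.primeCounting (Nat.sqrt (2 * 12 + 1)) ≤ 3 := by
  decide +kernel

theorem sn_count_13 : 3 ≤ ((Finset.Ioc 16 26).filter Nat.Prime).card := by
  refine sn_of_list _ _ [17, 19, 23] (by decide) ?_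
  simp only [List.forall_mem_cons]
  norm_num

theorem sn_root_13 : Nat.primeCounting (Nat.sqrt (2 * 16 + 1)) ≤ 3 := by
  decide +kernel

theorem sn_count_17 : 3 ≤ ((Finset.Ioc 22 34).filter Nat.Prime).card := by
  refine sn_of_list _ _ [23, 29, 31] (by decide) ?_
  simp only [List.forall_mem_cons]
  norm_num

theorem sn_root_17 : Nat.primeCounting (Nat.sqrt (2 * 22 + 1)) ≤ 3 := by
  decide +kernel

theorem sn_count_23 : 4 ≤ ((Finset.Ioc 30 46).filter Nat.Prime).card := by
  refine sn_of_list _ _ [31, 37, 41, 43] (by decide) ?_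
  simp only [List.forall_mem_cons]
  norm_num

theorem sn_root_23 : Nat.primeCounting (Nat.sqrt (2 * 30 + 1)) ≤ 4 := by
  decide +kernel

theorem sn_count_31 : 4 ≤ ((Finset.Ioc 46 62).filter Nat.Prime).card := by
  refine sn_of_list _ _ [47, 53, 59, 61] (by decide) ?_
  simp only [List.forall_mem_cons]
  norm_num

theorem sn_root_31 : Nat.primeCounting (Nat.sqrt (2 * 46 + 1)) ≤ 4 := by
  decide +kernel

theorem sn_count_47 : 5 ≤ ((Finset.Ioc 70 94).filter Nat.Prime).card := by
  refine sn_of_list _ _ [71, 73, 79, 83, 89] (by decide) ?_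
  simp only [List.forall_mem_cons]
  norm_num

theorem sn_root_47 : Nat.primeCounting (Nat.sqrt (2 * 70 + 1)) ≤ 5 := by
  decide +kernel

theorem sn_count_71 : 6 ≤ ((Finset.Ioc 99 142).filter Nat.Prime).card := by
  refine sn_of_list _ _ [101, 103, 107, 109, 113, 127] (by decide) ?_
  simp only [List.forall_mem_cons]
  norm_num

theorem sn_root_71 : Nat.primeCounting (Nat.sqrt (2 * 99 + 1)) ≤ 6 := by
  decide +kernel

theorem sn_count_100 : 7 ≤ ((Finset.Ioc 172 200).filter Nat.Prime).card := by
  refine sn_of_list _ _ [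
    173, 179, 181, 191, 193, 197, 199] (by decide) ?_
  simp only [List.forall_mem_cons]
  norm_num

theorem sn_root_100 : Nat.primeCounting (Nat.sqrt (2 * 172 + 1)) ≤ 7 := by
  decide +kernel

theorem sn_count_173 : 9 ≤ ((Finset.Ioc 280 346).filter Nat.Prime).card := by
  refine sn_of_list _ _ [
    281, 283, 293, 307, 311, 313, 317, 331, 337] (by decide) ?_
  simp only [List.forall_mem_cons]
  norm_num

theorem sn_root_173 : Nat.primeCounting (Nat.sqrt (2 * 280 + 1)) ≤ 9 := by
  decide +kernel

theorem sn_count_281 : 10 ≤ ((Finset.Ioc 479 562).filter Nat.Prime).card := by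
  refine sn_of_list _ _ [
    487, 491, 499, 503, 509, 521, 523, 541, 547, 557] (by decide) ?_
  simp only [List.forall_mem_cons]
  norm_num

theorem sn_root_281 : Nat.primeCounting (Nat.sqrt (2 * 479 + 1)) ≤ 10 := by
  decide +kernel

theorem sn_count_480 : 13 ≤ ((Finset.Ioc 862 960).filter Nat.Prime).card := by
  refine sn_of_list _ _ [
    863, 877, 881, 883, 887, 907, 911, 919, 929, 937, 941, 947, 953] (by decide) ?_
  simp only [List.forall_mem_cons]
  norm_num

theorem sn_root_480 : Nat.primeCounting (Nat.sqrt (2 * 862 + 1)) ≤ 13 := by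
  decide +kernel

theorem sn_count_863 : 16 ≤ ((Finset.Ioc 1608 1726).filter Nat.Prime).card := by
  refine sn_of_list _ _ [
    1609, 1613, 1619, 1621, 1627, 1637, 1657, 1663, 1667, 1669, 1693, 1697, 1699, 1709,
    1721, 1723] (by decide) ?_
  simp only [List.forall_mem_cons]
  norm_num

theorem sn_root_863 : Nat.primeCounting (Nat.sqrt (2 * 1608 + 1)) ≤ 16 := by
  decide +kernel

theorem sn_count_1609 : 21 ≤ ((Finset.Ioc 3036 3218).filter Nat.Prime).card := by
  refine sn_of_list _ _ [
    3037, 3041, 3049, 3061, 3067, 3079, 3083, 3089, 3109, 3119, 3121, 3137, 3163, 3167,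
    3169, 3181, 3187, 3191, 3203, 3209, 3217] (by decide) ?_
  simp only [List.forall_mem_cons]
  norm_num

theorem sn_root_1609 : Nat.primeCounting (Nat.sqrt (2 * 3036 + 1)) ≤ 21 := by
  decide +kernel

theorem sn_count_3037 : 28 ≤ ((Finset.Ioc 5826 6074).filter Nat.Prime).card := by
  refine sn_of_list _ _ [
    5827, 5839, 5843, 5849, 5851, 5857, 5861, 5867, 5869, 5879, 5881, 5897, 5903, 5923,
    5927, 5939, 5953, 5981, 5987, 6007, 6011, 6029, 6037, 6043, 6047, 6053, 6067, 6073] (by decide) ?_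
  simp only [List.forall_mem_cons]
  norm_num

theorem sn_root_3037 : Nat.primeCounting (Nat.sqrt (2 * 5826 + 1)) ≤ 28 := by
  decide +kernel

theorem sn_count_5827 : 35 ≤ ((Finset.Ioc 11286 11654).filter Nat.Prime).card := by
  refine sn_of_list _ _ [
    11287, 11299, 11311, 11317, 11321, 11329, 11351, 11353, 11369, 11383, 11393, 11399, 11411, 11423,
    11437, 11443, 11447, 11467, 11471, 11483, 11489, 11491, 11497, 11503, 11519, 11527, 11549, 11551,
    11579, 11587, 11593, 11597, 11617, 11621, 11633] (by decide) ?_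
  simp only [List.forall_mem_cons]
  norm_num

theorem sn_root_5827 : Nat.primeCounting (Nat.sqrt (2 * 11286 + 1)) ≤ 35 := by
  decide +kernel

theorem sn_all (n : ℕ) (h2 : 2 ≤ n) (h5 : n ≠ 5) :
    Nat.primeCounting (Nat.sqrt (2 * n + 1)) ≤
      ((Finset.Ioc n (2 * n)).filter Nat.Prime).card := by
  rcases lt_or_ge n 100 with h | h
  · rcases le_or_gt n 2 with h' | h'
    · exact sn_window 2 4 2 1 n (by omega) h' (by norm_num) sn_root_2 sn_count_2
    rcases le_or_gt n 3 with h' | h'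
    · exact sn_window 3 6 3 1 n (by omega) h' (by norm_num) sn_root_3 sn_count_3
    rcases le_or_gt n 4 with h' | h'
    · exact sn_window 4 8 4 2 n (by omega) h' (by norm_num) sn_root_4 sn_count_4
    rcases le_or_gt n 6 with h' | h'
    · exact sn_window 6 12 6 2 n (by omega) h' (by norm_num) sn_root_6 sn_count_6
    rcases le_or_gt n 10 with h' | h'
    · exact sn_window 7 14 10 2 n (by omega) h' (by norm_num) sn_root_7 sn_count_7
    rcases le_or_gt n 12 with h' | h'
    · exact sn_window 11 22 12 3 n (by omega) h' (by norm_num) sn_root_11 sn_count_11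
    rcases le_or_gt n 16 with h' | h'
    · exact sn_window 13 26 16 3 n (by omega) h' (by norm_num) sn_root_13 sn_count_13
    rcases le_or_gt n 22 with h' | h'
    · exact sn_window 17 34 22 3 n (by omega) h' (by norm_num) sn_root_17 sn_count_17
    rcases le_or_gt n 30 with h' | h'
    · exact sn_window 23 46 30 4 n (by omega) h' (by norm_num) sn_root_23 sn_count_23
    rcases le_or_gt n 46 with h' | h'
    · exact sn_window 31 62 46 4 n (by omega) h' (by norm_num) sn_root_31 sn_count_31
    rcases le_or_gt n 70 with h' | h'
    · exact sn_window 47 94 70 5 n (by omega) h' (by norm_num) sn_root_47 sn_count_47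
    rcases le_or_gt n 99 with h' | h'
    · exact sn_window 71 142 99 6 n (by omega) h' (by norm_num) sn_root_71 sn_count_71
    omega
  rcases le_or_gt n 172 with h' | h'
  · exact sn_window 100 200 172 7 n h h' (by norm_num) sn_root_100 sn_count_100
  rcases le_or_gt n 280 with h | h
  · exact sn_window 173 346 280 9 n h' h (by norm_num) sn_root_173 sn_count_173
  rcases le_or_gt n 479 with h' | h'
  · exact sn_window 281 562 479 10 n h h' (by norm_num) sn_root_281 sn_count_281
  rcases le_or_gt n 862 with h | h
  · exact sn_window 480 960 862 13 n h' h (by norm_num) sn_root_480 sn_count_480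
  rcases le_or_gt n 1608 with h' | h'
  · exact sn_window 863 1726 1608 16 n h h' (by norm_num) sn_root_863 sn_count_863
  rcases le_or_gt n 3036 with h | h
  · exact sn_window 1609 3218 3036 21 n h' h (by norm_num) sn_root_1609 sn_count_1609
  rcases le_or_gt n 5826 with h' | h'
  · exact sn_window 3037 6074 5826 28 n h h' (by norm_num) sn_root_3037 sn_count_3037
  rcases le_or_gt n 11286 with h | h
  · exact sn_window 5827 11654 11286 35 n h' h (by norm_num) sn_root_5827 sn_count_5827
  exact sn_large n (by omega)

theorem sn_pi_two_mul (n : ℕ) : Nat.primeCounting (2 * n) =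
    Nat.primeCounting n + ((Finset.Ioc n (2 * n)).filter Nat.Prime).card := by
  rw [← Nat.primesLE_card_eq_primeCounting, ← Nat.primesLE_card_eq_primeCounting,
    ← Finset.card_union_of_disjoint]
  · congr 1
    ext p
    simp only [Nat.mem_primesLE, Finset.mem_union, Finset.mem_filter, Finset.mem_Ioc]
    by_cases hp : p.Prime <;> simp only [hp, and_true, and_false, or_false]
    omega
  · rw [Finset.disjoint_left]
    intro p hp hq
    simp only [Nat.mem_primesLE, Finset.mem_filter, Finset.mem_Ioc] at hp hq
    omega

theorem sn_pi_mul (x y : ℕ) (hx : x.Prime) (hy : y.Prime) (hxy : x ≤ y) :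
    Nat.primeCounting x + Nat.primeCounting y ≤ Nat.primeCounting (x * y) := by
  have hx2 := hx.two_le
  have hxx : x * x ≤ x * y := Nat.mul_le_mul_left _ hxy
  have h2y : 2 * y ≤ x * y := Nat.mul_le_mul_right _ hx2
  by_cases h5 : x * y / 2 = 5
  · have hy5 : y ≤ 5 := by omega
    have hx3 : x ≤ 3 := by nlinarith [show x * y ≤ 11 by omega]
    interval_cases x <;> interval_cases y <;> first | omega | decide
  · obtain ⟨N, hN⟩ : ∃ N, N = x * y / 2 := ⟨_, rfl⟩
    have h := sn_all N (by omega) (by omega)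
    have h1 := sn_pi_two_mul N
    have h2 : Nat.primeCounting (2 * N) ≤ Nat.primeCounting (x * y) :=
      Nat.monotone_primeCounting (by omega)
    have h3 : Nat.primeCounting y ≤ Nat.primeCounting N :=
      Nat.monotone_primeCounting (by omega)
    have h4 : Nat.primeCounting x ≤ Nat.primeCounting (Nat.sqrt (2 * N + 1)) :=
      Nat.monotone_primeCounting (Nat.le_sqrt.2 (by omega))
    omega

theorem sn_pi_nthPrime (a : ℕ) (ha : 1 ≤ a) : Nat.primeCounting (nthPrime a) = a := by
  unfold nthPrime Nat.primeCounting Nat.primeCounting'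
  rw [Nat.count_succ, if_pos (Nat.prime_nth_prime _),
    Nat.count_nth_of_infinite Nat.infinite_setOfPred_prime]
  omega

theorem sn_nthPrime_le (a m : ℕ) (ha : 1 ≤ a) (h : a ≤ Nat.primeCounting m) :
    nthPrime a ≤ m := by
  have : Nat.nth Nat.Prime (a - 1) < m + 1 := Nat.nth_lt_of_lt_count (by
    unfold Nat.primeCounting Nat.primeCounting' at h
    omega)
  unfold nthPrime
  omega

theorem sn_nthPrime_add (a b : ℕ) (ha : 1 ≤ a) (hb : 1 ≤ b) :
    nthPrime (a + b) ≤ nthPrime a * nthPrime b := by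
  apply sn_nthPrime_le _ _ (by omega)
  have pa : (nthPrime a).Prime := Nat.prime_nth_prime _
  have pb : (nthPrime b).Prime := Nat.prime_nth_prime _
  have ea := sn_pi_nthPrime a ha
  have eb := sn_pi_nthPrime b hb
  rcases le_total (nthPrime a) (nthPrime b) with h | h
  · have := sn_pi_mul _ _ pa pb h
    omega
  · have := sn_pi_mul _ _ pb pa h
    rw [mul_comm]
    omega

theorem sn_nthPrime_le_two_pow (a : ℕ) (ha : 1 ≤ a) : nthPrime a ≤ 2 ^ a := by
  have h1 : nthPrime 1 = 2 := Nat.nth_prime_zero_eq_two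
  induction a, ha using Nat.le_induction with
  | base => rw [h1]; norm_num
  | succ m hm ih =>
    have := sn_nthPrime_add m 1 hm le_rfl
    rw [h1] at this
    rw [pow_succ]
    omega

theorem supernorm_interval (n : ℕ) (hn : 1 ≤ n) (L : Multiset ℕ)
    (hparts : ∀ i ∈ L, 1 ≤ i) (hsize : L.sum = n) :
    nthPrime n ≤ supernorm L ∧ supernorm L ≤ 2 ^ n := by
  subst hsize
  have key : (L ≠ 0 → nthPrime L.sum ≤ supernorm L) ∧ supernorm L ≤ 2 ^ L.sum := by
    clear hn
    induction L using Multiset.induction_on with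
    | empty => simp [supernorm]
    | cons a L ih =>
      have ha : 1 ≤ a := hparts a (Multiset.mem_cons_self _ _)
      have hL : ∀ i ∈ L, 1 ≤ i := fun i hi => hparts i (Multiset.mem_cons_of_mem hi)
      obtain ⟨i1, i2⟩ := ih hL
      have e : supernorm (a ::ₘ L) = nthPrime a * supernorm L := by simp [supernorm]
      rw [e, Multiset.sum_cons]
      constructor
      · intro _
        by_cases h0 : L = 0
        · subst h0; simp [supernorm]
        · obtain ⟨b, hb⟩ := Multiset.exists_mem_of_ne_zero h0
          have hs : 1 ≤ L.sum := (hL b hb).trans (Multiset.le_sum_of_mem hb)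
          exact (sn_nthPrime_add a L.sum ha hs).trans (Nat.mul_le_mul_left _ (i1 h0))
      · rw [pow_add]
        exact Nat.mul_le_mul (sn_nthPrime_le_two_pow a ha) i2
  refine ⟨key.1 ?_, key.2⟩
  rintro rfl
  simp at hn
end

section
/- For all positive integers b, p_{2b} ≤ 3 · p_b, where p_n denotes the n-th prime number. -/
/-- Counts the `i < len` such that `s + 2 i` is coprime to `P`, by bisection. -/
def cnt (P : ℕ) : ℕ → ℕ → ℕ → ℕ := fun d =>
  Nat.rec (fun s len => bif Nat.beq len 0 then 0 else bif Nat.beq (Nat.gcd s P) 1 then 1 else 0)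
    (fun _ ih s len => Nat.add (ih s (Nat.div len 2))
      (ih (Nat.add s (Nat.mul 2 (Nat.div len 2))) (Nat.sub len (Nat.div len 2)))) d

theorem cnt_zero (P s len : ℕ) : cnt P 0 s len =
    bif Nat.beq len 0 then 0 else bif Nat.beq (Nat.gcd s P) 1 then 1 else 0 := rfl

theorem cnt_succ (P d s len : ℕ) : cnt P (d + 1) s len =
    cnt P d s (len / 2) + cnt P d (s + 2 * (len / 2)) (len - len / 2) := rfl

theorem prime_iff_gcd (B s : ℕ) (h1 : B < s) (hB : 1 ≤ B) (h2 : s < (B + 1) ^ 2) :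
    Nat.gcd s (Nat.factorial B) = 1 ↔ s.Prime := by
  constructor
  · intro h
    by_contra hp
    have hs : 2 ≤ s := by omega
    have hm := Nat.minFac_sq_le_self (by omega : 0 < s) hp
    have hlt : s.minFac < B + 1 := lt_of_pow_lt_pow_left₀ 2 (by omega) (lt_of_le_of_lt hm h2)
    have hd : s.minFac ∣ Nat.factorial B := Nat.dvd_factorial (Nat.minFac_pos s) (by omega)
    have := Nat.dvd_gcd (Nat.minFac_dvd s) hd
    rw [h] at this
    have h3 := (Nat.minFac_prime (by omega : s ≠ 1)).two_le
    have := Nat.le_of_dvd one_pos this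
    omega
  · intro hp
    exact (Nat.coprime_factorial_iff (n := B) (m := s) (by omega)).2
      (by rw [hp.minFac_eq]; exact h1)

theorem cnt_spec (B P : ℕ) (hP : P = Nat.factorial B) (hB : 2 ≤ B) (d : ℕ) :
    ∀ a len, a % 2 = 0 → B ≤ a → a + 2 * len ≤ (B + 1) ^ 2 → len ≤ 2 ^ d →
      Nat.primeCounting (a + 2 * len) = Nat.primeCounting a + cnt P d (a + 1) len := by
  induction d with
  | zero =>
    intro a len ha hBa hle hl
    have : len = 0 ∨ len = 1 := by simp at hl; omega
    rcases this with rfl | rfl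
    · simp [cnt_zero]
    · rw [cnt_zero]
      have h1 : Nat.primeCounting (a + 2 * 1) = Nat.count Nat.Prime (a + 1 + 1 + 1) := rfl
      have h2 : Nat.primeCounting a = Nat.count Nat.Prime (a + 1) := rfl
      rw [h1, h2, Nat.count_succ, Nat.count_succ]
      have he : ¬ (a + 1 + 1).Prime := by
        intro h
        rcases h.eq_two_or_odd with h | h <;> omega
      have hiff := prime_iff_gcd B (a + 1) (by omega) (by omega) (by omega)
      rw [← hP] at hiff
      rw [if_neg he]
      by_cases hp : (a + 1).Prime
      · have h3 := hiff.2 hp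
        have h4 : Nat.beq 1 0 = false := rfl
        simp [hp, h3, h4]
      · have h3 : Nat.beq (Nat.gcd (a + 1) P) 1 = false := by
          rw [Bool.eq_false_iff]
          intro h
          exact hp (hiff.1 (Nat.eq_of_beq_eq_true h))
        have h4 : Nat.beq 1 0 = false := rfl
        simp [hp, h3, h4]
  | succ d ih =>
    intro a len ha hBa hle hl
    rw [cnt_succ]
    have hp : 2 ^ (d + 1) = 2 * 2 ^ d := by ring
    have e1 := ih a (len / 2) ha hBa (by omega) (by omega)
    have e2 := ih (a + 2 * (len / 2)) (len - len / 2) (by omega) (by omega) (by omega) (by omega)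
    have h3 : a + 2 * (len / 2) + 2 * (len - len / 2) = a + 2 * len := by omega
    have h4 : a + 1 + 2 * (len / 2) = a + 2 * (len / 2) + 1 := by omega
    rw [h3, e1] at e2
    rw [e2, h4]
    ring

def fac896 : ℕ := 1036108419742996247432825640343965309607409169743421232010507676953490755897446481020228710836155878864156363163408095123116386602380033530459870677787044089014359653511069744917680657977213219158108804401033831795025729856286381360984186524403406209613607727589387661861139082433012629088730469478289917670552045236433280647727282793296870772356227890345098089671707104985647873379382096531681402980175404071609771291008027828024229048155235903632790986177646976570827889687218060375172324318370399070680912640040124778445599903060449259117997784065019308378085076659247907625027319613850209685193206334372472771681319793748236925930074666094070405002775193749213710796074429516115941982929082675917732826506797757514939084044879724451127548274826423507064030360350209397996018682608835997490852423979256151088287848112726809702209822156020715484650941477760418128334742025460158623697505146437596576568121202858779619092180714044433825373648367717446164141389400589498947003059243226636751157416082736294377963251397699166561234859519137692972371120236501724287783309993445566048829357725299492296823570301130499121538533953974543168551751993406554567938571097287218888926153915788983319161393610796240834563704988803896225920075411032127858616246739120105917868327591869207380041918101300179804678324987632623694913255374456499798250416474420197785502827017789003642177843404003513428325596128085692494685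47457189840284852568306579721659838488160383510392828512055425852175884889822416137953319006870201083655294694355546193697570437860905702133117136271658346297783789384013375071960744821561099135216238362720864372012935444082715837945499831751205048642256266053803286542377667325636889648908732063578378231734319367698987250334346027874184093155603828265037424661779047785068246063104938137305006609989703555087472168688371621032855469673344351453796041552095274176912048775303185201116212281573585942357321318253624581015964980684641634803705431536776706349784423724697802007551773012099320285619699655081325053117371742832033792000000000000000000000000000000000000000000000000000000000000000000000000000000000000000000000000000000000000000000000000000000000000000000000000000000000000000000000000000000000000000000000000000000000000000000000000000000
def fac31 : ℕ := 8222838654177922817725562880000000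

theorem fac31_eq : fac31 = Nat.factorial 31 := by decide +kernel

theorem fac896_eq : fac896 = Nat.factorial 896 := by decide +kernel

theorem fac31_step (a len d c k : ℕ) (h : Nat.primeCounting a = c) (h1 : a % 2 = 0) (h2 : 31 ≤ a)
    (h3 : a + 2 * len ≤ 1024) (h4 : len ≤ 2 ^ d) (h5 : cnt fac31 d (a + 1) len = k) :
    Nat.primeCounting (a + 2 * len) = c + k := by
  rw [cnt_spec 31 fac31 fac31_eq (by norm_num) d a len h1 h2 (by norm_num; exact h3) h4, h, h5]

theorem fac896_step (a len d c k : ℕ) (h : Nat.primeCounting a = c) (h1 : a % 2 = 0)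
    (h2 : 896 ≤ a) (h3 : a + 2 * len ≤ 804609) (h4 : len ≤ 2 ^ d)
    (h5 : cnt fac896 d (a + 1) len = k) :
    Nat.primeCounting (a + 2 * len) = c + k := by
  rw [cnt_spec 896 fac896 fac896_eq (by norm_num) d a len h1 h2 (by norm_num; exact h3) h4, h, h5]

theorem pi_grid (a b c e : ℕ) (hb : Nat.primeCounting b = c) (ha : Nat.primeCounting (3 * a) = e)
    (hce : 2 * c ≤ e) (n : ℕ) (h1 : a ≤ n) (h2 : n ≤ b) :
    2 * Nat.primeCounting n ≤ Nat.primeCounting (3 * n) := by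
  have e1 := Nat.monotone_primeCounting h2
  have e2 := Nat.monotone_primeCounting (show 3 * a ≤ 3 * n by omega)
  omega

theorem pi_32 : Nat.primeCounting 32 = 11 := by decide +kernel

theorem pi_40 : Nat.primeCounting 40 = 12 :=
  fac31_step 32 4 3 11 1 pi_32 (by decide) (by decide) (by decide) (by decide) (by decide +kernel)

theorem pi_52 : Nat.primeCounting 52 = 15 :=
  fac31_step 40 6 3 12 3 pi_40 (by decide) (by decide) (by decide) (by decide) (by decide +kernel)

theorem pi_66 : Nat.primeCounting 66 = 18 :=
  fac31_step 52 7 3 15 3 pi_52 (by decide) (by decide) (by decide) (by decide) (by decide +kernel)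

theorem pi_82 : Nat.primeCounting 82 = 22 :=
  fac31_step 66 8 4 18 4 pi_66 (by decide) (by decide) (by decide) (by decide) (by decide +kernel)

theorem pi_96 : Nat.primeCounting 96 = 24 :=
  fac31_step 82 7 3 22 2 pi_82 (by decide) (by decide) (by decide) (by decide) (by decide +kernel)

theorem pi_102 : Nat.primeCounting 102 = 26 :=
  fac31_step 96 3 2 24 2 pi_96 (by decide) (by decide) (by decide) (by decide) (by decide +kernel)

theorem pi_120 : Nat.primeCounting 120 = 30 :=
  fac31_step 102 9 4 26 4 pi_102 (by decide) (by decide) (by decide) (by decide) (by decide +kernel)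

theorem pi_130 : Nat.primeCounting 130 = 31 :=
  fac31_step 120 5 3 30 1 pi_120 (by decide) (by decide) (by decide) (by decide) (by decide +kernel)

theorem pi_156 : Nat.primeCounting 156 = 36 :=
  fac31_step 130 13 4 31 5 pi_130 (by decide) (by decide) (by decide) (by decide) (by decide +kernel)

theorem pi_166 : Nat.primeCounting 166 = 38 :=
  fac31_step 156 5 3 36 2 pi_156 (by decide) (by decide) (by decide) (by decide) (by decide +kernel)

theorem pi_198 : Nat.primeCounting 198 = 45 :=
  fac31_step 166 16 5 38 7 pi_166 (by decide) (by decide) (by decide) (by decide) (by decide +kernel)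

theorem pi_222 : Nat.primeCounting 222 = 47 :=
  fac31_step 198 12 4 45 2 pi_198 (by decide) (by decide) (by decide) (by decide) (by decide +kernel)

theorem pi_246 : Nat.primeCounting 246 = 53 :=
  fac31_step 222 12 4 47 6 pi_222 (by decide) (by decide) (by decide) (by decide) (by decide +kernel)

theorem pi_282 : Nat.primeCounting 282 = 60 :=
  fac31_step 246 18 5 53 7 pi_246 (by decide) (by decide) (by decide) (by decide) (by decide +kernel)

theorem pi_306 : Nat.primeCounting 306 = 62 :=
  fac31_step 282 12 4 60 2 pi_282 (by decide) (by decide) (by decide) (by decide) (by decide +kernel)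

theorem pi_372 : Nat.primeCounting 372 = 73 :=
  fac31_step 306 33 6 62 11 pi_306 (by decide) (by decide) (by decide) (by decide) (by decide +kernel)

theorem pi_390 : Nat.primeCounting 390 = 77 :=
  fac31_step 372 9 4 73 4 pi_372 (by decide) (by decide) (by decide) (by decide) (by decide +kernel)

theorem pi_490 : Nat.primeCounting 490 = 93 :=
  fac31_step 390 50 6 77 16 pi_390 (by decide) (by decide) (by decide) (by decide) (by decide +kernel)

theorem pi_498 : Nat.primeCounting 498 = 94 :=
  fac31_step 490 4 3 93 1 pi_490 (by decide) (by decide) (by decide) (by decide) (by decide +kernel)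

theorem pi_642 : Nat.primeCounting 642 = 116 :=
  fac31_step 498 72 7 94 22 pi_498 (by decide) (by decide) (by decide) (by decide) (by decide +kernel)

theorem pi_666 : Nat.primeCounting 666 = 121 :=
  fac31_step 642 12 4 116 5 pi_642 (by decide) (by decide) (by decide) (by decide) (by decide +kernel)

theorem pi_846 : Nat.primeCounting 846 = 146 :=
  fac31_step 666 90 7 121 25 pi_666 (by decide) (by decide) (by decide) (by decide) (by decide +kernel)

theorem pi_852 : Nat.primeCounting 852 = 146 :=
  fac31_step 846 3 2 146 0 pi_846 (by decide) (by decide) (by decide) (by decide) (by decide +kernel)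

theorem pi_1000 : Nat.primeCounting 1000 = 168 :=
  fac31_step 852 74 7 146 22 pi_852 (by decide) (by decide) (by decide) (by decide) (by decide +kernel)

theorem pi_1116 : Nat.primeCounting 1116 = 186 :=
  fac896_step 1000 58 6 168 18 pi_1000 (by decide) (by decide) (by decide) (by decide) (by decide +kernel)

theorem pi_1122 : Nat.primeCounting 1122 = 187 :=
  fac896_step 1116 3 2 186 1 pi_1116 (by decide) (by decide) (by decide) (by decide) (by decide +kernel)

theorem pi_1470 : Nat.primeCounting 1470 = 232 :=
  fac896_step 1122 174 8 187 45 pi_1122 (by decide) (by decide) (by decide) (by decide) (by decide +kernel)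

theorem pi_1492 : Nat.primeCounting 1492 = 237 :=
  fac896_step 1470 11 4 232 5 pi_1470 (by decide) (by decide) (by decide) (by decide) (by decide +kernel)

theorem pi_1926 : Nat.primeCounting 1926 = 293 :=
  fac896_step 1492 217 8 237 56 pi_1492 (by decide) (by decide) (by decide) (by decide) (by decide +kernel)

theorem pi_2002 : Nat.primeCounting 2002 = 303 :=
  fac896_step 1926 38 6 293 10 pi_1926 (by decide) (by decide) (by decide) (by decide) (by decide +kernel)

theorem pi_2556 : Nat.primeCounting 2556 = 374 :=
  fac896_step 2002 277 9 303 71 pi_2002 (by decide) (by decide) (by decide) (by decide) (by decide +kernel)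

theorem pi_2692 : Nat.primeCounting 2692 = 391 :=
  fac896_step 2556 68 7 374 17 pi_2556 (by decide) (by decide) (by decide) (by decide) (by decide +kernel)

theorem pi_3366 : Nat.primeCounting 3366 = 474 :=
  fac896_step 2692 337 9 391 83 pi_2692 (by decide) (by decide) (by decide) (by decide) (by decide +kernel)

theorem pi_3630 : Nat.primeCounting 3630 = 507 :=
  fac896_step 3366 132 8 474 33 pi_3366 (by decide) (by decide) (by decide) (by decide) (by decide +kernel)

theorem pi_4476 : Nat.primeCounting 4476 = 607 :=
  fac896_step 3630 423 9 507 100 pi_3630 (by decide) (by decide) (by decide) (by decide) (by decide +kernel)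

theorem pi_4956 : Nat.primeCounting 4956 = 662 :=
  fac896_step 4476 240 8 607 55 pi_4476 (by decide) (by decide) (by decide) (by decide) (by decide +kernel)

theorem pi_6006 : Nat.primeCounting 6006 = 783 :=
  fac896_step 4956 525 10 662 121 pi_4956 (by decide) (by decide) (by decide) (by decide) (by decide +kernel)

theorem pi_6762 : Nat.primeCounting 6762 = 870 :=
  fac896_step 6006 378 9 783 87 pi_6006 (by decide) (by decide) (by decide) (by decide) (by decide +kernel)

theorem pi_8076 : Nat.primeCounting 8076 = 1014 :=
  fac896_step 6762 657 10 870 144 pi_6762 (by decide) (by decide) (by decide) (by decide) (by decide +kernel)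

theorem pi_9240 : Nat.primeCounting 9240 = 1145 :=
  fac896_step 8076 582 10 1014 131 pi_8076 (by decide) (by decide) (by decide) (by decide) (by decide +kernel)

theorem pi_10890 : Nat.primeCounting 10890 = 1324 :=
  fac896_step 9240 825 10 1145 179 pi_9240 (by decide) (by decide) (by decide) (by decide) (by decide +kernel)

theorem pi_12652 : Nat.primeCounting 12652 = 1511 :=
  fac896_step 10890 881 10 1324 187 pi_10890 (by decide) (by decide) (by decide) (by decide) (by decide +kernel)

theorem pi_14868 : Nat.primeCounting 14868 = 1741 :=
  fac896_step 12652 1108 11 1511 230 pi_12652 (by decide) (by decide) (by decide) (by decide) (by decide +kernel)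

theorem pi_17442 : Nat.primeCounting 17442 = 2005 :=
  fac896_step 14868 1287 11 1741 264 pi_14868 (by decide) (by decide) (by decide) (by decide) (by decide +kernel)

theorem pi_20286 : Nat.primeCounting 20286 = 2291 :=
  fac896_step 17442 1422 11 2005 286 pi_17442 (by decide) (by decide) (by decide) (by decide) (by decide +kernel)

theorem pi_24048 : Nat.primeCounting 24048 = 2674 :=
  fac896_step 20286 1881 11 2291 383 pi_20286 (by decide) (by decide) (by decide) (by decide) (by decide +kernel)

theorem pi_27720 : Nat.primeCounting 27720 = 3022 :=
  fac896_step 24048 1836 11 2674 348 pi_24048 (by decide) (by decide) (by decide) (by decide) (by decide +kernel)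

theorem pi_33346 : Nat.primeCounting 33346 = 3570 :=
  fac896_step 27720 2813 12 3022 548 pi_27720 (by decide) (by decide) (by decide) (by decide) (by decide +kernel)

theorem pi_37956 : Nat.primeCounting 37956 = 4010 :=
  fac896_step 33346 2305 12 3570 440 pi_33346 (by decide) (by decide) (by decide) (by decide) (by decide +kernel)

theorem pi_46438 : Nat.primeCounting 46438 = 4797 :=
  fac896_step 37956 4241 13 4010 787 pi_37956 (by decide) (by decide) (by decide) (by decide) (by decide +kernel)

theorem pi_52326 : Nat.primeCounting 52326 = 5349 :=
  fac896_step 46438 2944 12 4797 552 pi_46438 (by decide) (by decide) (by decide) (by decide) (by decide +kernel)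

theorem pi_64780 : Nat.primeCounting 64780 = 6474 :=
  fac896_step 52326 6227 13 5349 1125 pi_52326 (by decide) (by decide) (by decide) (by decide) (by decide +kernel)

theorem pi_72144 : Nat.primeCounting 72144 = 7141 :=
  fac896_step 64780 3682 12 6474 667 pi_64780 (by decide) (by decide) (by decide) (by decide) (by decide +kernel)

theorem pi_90510 : Nat.primeCounting 90510 = 8761 :=
  fac896_step 72144 9183 14 7141 1620 pi_72144 (by decide) (by decide) (by decide) (by decide) (by decide +kernel)

theorem pi_100038 : Nat.primeCounting 100038 = 9594 :=
  fac896_step 90510 4764 13 8761 833 pi_90510 (by decide) (by decide) (by decide) (by decide) (by decide +kernel)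

theorem pi_126750 : Nat.primeCounting 126750 = 11884 :=
  fac896_step 100038 13356 14 9594 2290 pi_100038 (by decide) (by decide) (by decide) (by decide) (by decide +kernel)

theorem pi_139314 : Nat.primeCounting 139314 = 12949 :=
  fac896_step 126750 6282 13 11884 1065 pi_126750 (by decide) (by decide) (by decide) (by decide) (by decide +kernel)

theorem pi_177978 : Nat.primeCounting 177978 = 16158 :=
  fac896_step 139314 19332 15 12949 3209 pi_139314 (by decide) (by decide) (by decide) (by decide) (by decide +kernel)

theorem pi_194340 : Nat.primeCounting 194340 = 17523 :=
  fac896_step 177978 8181 13 16158 1365 pi_177978 (by decide) (by decide) (by decide) (by decide) (by decide +kernel)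

theorem pi_250168 : Nat.primeCounting 250168 = 22059 :=
  fac896_step 194340 27914 15 17523 4536 pi_194340 (by decide) (by decide) (by decide) (by decide) (by decide +kernel)

theorem pi_262144 : Nat.primeCounting 262144 = 23000 :=
  fac896_step 250168 5988 13 22059 941 pi_250168 (by decide) (by decide) (by decide) (by decide) (by decide +kernel)

theorem pi_271530 : Nat.primeCounting 271530 = 23768 :=
  fac896_step 262144 4693 13 23000 768 pi_262144 (by decide) (by decide) (by decide) (by decide) (by decide +kernel)

theorem pi_380250 : Nat.primeCounting 380250 = 32316 :=
  fac896_step 271530 54360 16 23768 8548 pi_271530 (by decide) (by decide) (by decide) (by decide) (by decide +kernel)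

theorem pi_533934 : Nat.primeCounting 533934 = 44119 :=
  fac896_step 380250 76842 17 32316 11803 pi_380250 (by decide) (by decide) (by decide) (by decide) (by decide +kernel)

theorem pi_750504 : Nat.primeCounting 750504 = 60271 :=
  fac896_step 533934 108285 17 44119 16152 pi_533934 (by decide) (by decide) (by decide) (by decide) (by decide +kernel)

theorem pi_small_range (n : ℕ) (h0 : 32 ≤ n) (hn : n ≤ 262144) :
    2 * Nat.primeCounting n ≤ Nat.primeCounting (3 * n) := by
  rcases Nat.lt_or_ge n 250168 with h | h
  swap
  · exact pi_grid 250168 262144 23000 60271 pi_262144 pi_750504 (by decide) n h (by omega)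
  rcases Nat.lt_or_ge n 177978 with h | h
  swap
  · exact pi_grid 177978 250168 22059 44119 pi_250168 pi_533934 (by decide) n h (by omega)
  rcases Nat.lt_or_ge n 126750 with h | h
  swap
  · exact pi_grid 126750 177978 16158 32316 pi_177978 pi_380250 (by decide) n h (by omega)
  rcases Nat.lt_or_ge n 90510 with h | h
  swap
  · exact pi_grid 90510 126750 11884 23768 pi_126750 pi_271530 (by decide) n h (by omega)
  rcases Nat.lt_or_ge n 64780 with h | h
  swap
  · exact pi_grid 64780 90510 8761 17523 pi_90510 pi_194340 (by decide) n h (by omega)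
  rcases Nat.lt_or_ge n 46438 with h | h
  swap
  · exact pi_grid 46438 64780 6474 12949 pi_64780 pi_139314 (by decide) n h (by omega)
  rcases Nat.lt_or_ge n 33346 with h | h
  swap
  · exact pi_grid 33346 46438 4797 9594 pi_46438 pi_100038 (by decide) n h (by omega)
  rcases Nat.lt_or_ge n 24048 with h | h
  swap
  · exact pi_grid 24048 33346 3570 7141 pi_33346 pi_72144 (by decide) n h (by omega)
  rcases Nat.lt_or_ge n 17442 with h | h
  swap
  · exact pi_grid 17442 24048 2674 5349 pi_24048 pi_52326 (by decide) n h (by omega)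
  rcases Nat.lt_or_ge n 12652 with h | h
  swap
  · exact pi_grid 12652 17442 2005 4010 pi_17442 pi_37956 (by decide) n h (by omega)
  rcases Nat.lt_or_ge n 9240 with h | h
  swap
  · exact pi_grid 9240 12652 1511 3022 pi_12652 pi_27720 (by decide) n h (by omega)
  rcases Nat.lt_or_ge n 6762 with h | h
  swap
  · exact pi_grid 6762 9240 1145 2291 pi_9240 pi_20286 (by decide) n h (by omega)
  rcases Nat.lt_or_ge n 4956 with h | h
  swap
  · exact pi_grid 4956 6762 870 1741 pi_6762 pi_14868 (by decide) n h (by omega)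
  rcases Nat.lt_or_ge n 3630 with h | h
  swap
  · exact pi_grid 3630 4956 662 1324 pi_4956 pi_10890 (by decide) n h (by omega)
  rcases Nat.lt_or_ge n 2692 with h | h
  swap
  · exact pi_grid 2692 3630 507 1014 pi_3630 pi_8076 (by decide) n h (by omega)
  rcases Nat.lt_or_ge n 2002 with h | h
  swap
  · exact pi_grid 2002 2692 391 783 pi_2692 pi_6006 (by decide) n h (by omega)
  rcases Nat.lt_or_ge n 1492 with h | h
  swap
  · exact pi_grid 1492 2002 303 607 pi_2002 pi_4476 (by decide) n h (by omega)
  rcases Nat.lt_or_ge n 1122 with h | h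
  swap
  · exact pi_grid 1122 1492 237 474 pi_1492 pi_3366 (by decide) n h (by omega)
  rcases Nat.lt_or_ge n 852 with h | h
  swap
  · exact pi_grid 852 1122 187 374 pi_1122 pi_2556 (by decide) n h (by omega)
  rcases Nat.lt_or_ge n 642 with h | h
  swap
  · exact pi_grid 642 852 146 293 pi_852 pi_1926 (by decide) n h (by omega)
  rcases Nat.lt_or_ge n 490 with h | h
  swap
  · exact pi_grid 490 642 116 232 pi_642 pi_1470 (by decide) n h (by omega)
  rcases Nat.lt_or_ge n 372 with h | h
  swap
  · exact pi_grid 372 490 93 186 pi_490 pi_1116 (by decide) n h (by omega)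
  rcases Nat.lt_or_ge n 282 with h | h
  swap
  · exact pi_grid 282 372 73 146 pi_372 pi_846 (by decide) n h (by omega)
  rcases Nat.lt_or_ge n 222 with h | h
  swap
  · exact pi_grid 222 282 60 121 pi_282 pi_666 (by decide) n h (by omega)
  rcases Nat.lt_or_ge n 166 with h | h
  swap
  · exact pi_grid 166 222 47 94 pi_222 pi_498 (by decide) n h (by omega)
  rcases Nat.lt_or_ge n 130 with h | h
  swap
  · exact pi_grid 130 166 38 77 pi_166 pi_390 (by decide) n h (by omega)
  rcases Nat.lt_or_ge n 102 with h | h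
  swap
  · exact pi_grid 102 130 31 62 pi_130 pi_306 (by decide) n h (by omega)
  rcases Nat.lt_or_ge n 82 with h | h
  swap
  · exact pi_grid 82 102 26 53 pi_102 pi_246 (by decide) n h (by omega)
  rcases Nat.lt_or_ge n 66 with h | h
  swap
  · exact pi_grid 66 82 22 45 pi_82 pi_198 (by decide) n h (by omega)
  rcases Nat.lt_or_ge n 52 with h | h
  swap
  · exact pi_grid 52 66 18 36 pi_66 pi_156 (by decide) n h (by omega)
  rcases Nat.lt_or_ge n 40 with h | h
  swap
  · exact pi_grid 40 52 15 30 pi_52 pi_120 (by decide) n h (by omega)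
  rcases Nat.lt_or_ge n 32 with h | h
  swap
  · exact pi_grid 32 40 12 24 pi_40 pi_96 (by decide) n h (by omega)
  omega

theorem tiny_range (n : ℕ) (h : n < 32) :
    2 * Nat.primeCounting n ≤ Nat.primeCounting (3 * n) := by
  have : ∀ n < 32, 2 * Nat.primeCounting n ≤ Nat.primeCounting (3 * n) := by decide +kernel
  exact this n h

open Finset ArithmeticFunction in
theorem log_factorial_eq (n : ℕ) (N : ℕ) (h : n ≤ N) :
    Real.log (Nat.factorial n) = ∑ k ∈ Ioc 0 N, vonMangoldt k * ((n / k : ℕ) : ℝ) := by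
  induction n with
  | zero => simp
  | succ n ih =>
    have ih := ih (by omega)
    rw [Nat.factorial_succ, Nat.cast_mul, Real.log_mul (by positivity) (by positivity), ih,
      ← vonMangoldt_sum]
    have h1 : (n + 1).divisors = (Ioc 0 N).filter (fun k => k ∣ n + 1) := by
      ext k
      simp only [Nat.mem_divisors, mem_filter, mem_Ioc]
      constructor
      · rintro ⟨hk, _⟩
        have := Nat.le_of_dvd (by omega) hk
        have := Nat.pos_of_dvd_of_pos hk (by omega)
        exact ⟨⟨this, by omega⟩, hk⟩
      · rintro ⟨_, hk⟩
        exact ⟨hk, by omega⟩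
    rw [h1, sum_filter, ← sum_add_distrib]
    apply sum_congr rfl
    intro k _
    rw [Nat.succ_div]
    split_ifs <;> push_cast <;> ring

/-- Chebyshev's combination of factorials. -/
noncomputable def chebS (n : ℕ) : ℝ :=
  Real.log (Nat.factorial n) - Real.log (Nat.factorial (n / 2)) - Real.log (Nat.factorial (n / 3))
    - Real.log (Nat.factorial (n / 5)) + Real.log (Nat.factorial (n / 30))

open Finset ArithmeticFunction in
theorem chebS_eq (n : ℕ) : chebS n = ∑ k ∈ Ioc 0 n, vonMangoldt k *
    (((n / k : ℕ) : ℝ) - ((n / k / 2 : ℕ) : ℝ) - ((n / k / 3 : ℕ) : ℝ) - ((n / k / 5 : ℕ) : ℝ)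
      + ((n / k / 30 : ℕ) : ℝ)) := by
  unfold chebS
  rw [log_factorial_eq n n le_rfl, log_factorial_eq (n / 2) n (Nat.div_le_self _ _),
    log_factorial_eq (n / 3) n (Nat.div_le_self _ _),
    log_factorial_eq (n / 5) n (Nat.div_le_self _ _),
    log_factorial_eq (n / 30) n (Nat.div_le_self _ _),
    ← sum_sub_distrib, ← sum_sub_distrib, ← sum_sub_distrib, ← sum_add_distrib]
  apply sum_congr rfl
  intro k _
  rw [Nat.div_right_comm n 2 k, Nat.div_right_comm n 3 k, Nat.div_right_comm n 5 k,
    Nat.div_right_comm n 30 k]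
  ring

theorem cheb_coeff_le (m : ℕ) : ((m : ℕ) : ℝ) - ((m / 2 : ℕ) : ℝ) - ((m / 3 : ℕ) : ℝ)
    - ((m / 5 : ℕ) : ℝ) + ((m / 30 : ℕ) : ℝ) ≤ 1 := by
  have : m + m / 30 ≤ 1 + m / 2 + m / 3 + m / 5 := by omega
  have : ((m + m / 30 : ℕ) : ℝ) ≤ ((1 + m / 2 + m / 3 + m / 5 : ℕ) : ℝ) := by exact_mod_cast this
  push_cast at this
  linarith

theorem cheb_coeff_nonneg (m : ℕ) : 0 ≤ ((m : ℕ) : ℝ) - ((m / 2 : ℕ) : ℝ) - ((m / 3 : ℕ) : ℝ)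
    - ((m / 5 : ℕ) : ℝ) + ((m / 30 : ℕ) : ℝ) := by
  have : m / 2 + m / 3 + m / 5 ≤ m + m / 30 := by omega
  have : ((m / 2 + m / 3 + m / 5 : ℕ) : ℝ) ≤ ((m + m / 30 : ℕ) : ℝ) := by exact_mod_cast this
  push_cast at this
  linarith

theorem cheb_coeff_ge (m : ℕ) (h1 : 1 ≤ m) (h2 : m < 6) :
    1 ≤ ((m : ℕ) : ℝ) - ((m / 2 : ℕ) : ℝ) - ((m / 3 : ℕ) : ℝ)
    - ((m / 5 : ℕ) : ℝ) + ((m / 30 : ℕ) : ℝ) := by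
  interval_cases m <;> norm_num

open Finset ArithmeticFunction in
theorem chebS_le_psi (n : ℕ) : chebS n ≤ Chebyshev.psi n := by
  rw [chebS_eq, Chebyshev.psi, Nat.floor_natCast]
  apply sum_le_sum
  intro k _
  exact mul_le_of_le_one_right vonMangoldt_nonneg (cheb_coeff_le _)

theorem theta_nat_diff (a b : ℕ) (h : a ≤ b) : Chebyshev.theta b - Chebyshev.theta a =
    ∑ p ∈ (Finset.Ioc a b).filter Nat.Prime, Real.log p := by
  unfold Chebyshev.theta
  rw [Nat.floor_natCast, Nat.floor_natCast, Finset.sum_filter, Finset.sum_filter,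
    Finset.sum_filter, ← Finset.sum_Ioc_consecutive _ (Nat.zero_le a) h]
  ring

theorem pi_nat_diff (a b : ℕ) (h : a ≤ b) :
    (Nat.primeCounting b : ℝ) - Nat.primeCounting a =
    ∑ p ∈ (Finset.Ioc a b).filter Nat.Prime, (1 : ℝ) := by
  have key : ∀ n, (Nat.primeCounting n : ℝ) = ∑ p ∈ (Finset.Ioc 0 n).filter Nat.Prime, (1 : ℝ) := by
    intro n
    induction n with
    | zero => simp
    | succ n ih =>
      have h1 : Nat.primeCounting (n + 1) = Nat.count Nat.Prime (n + 1 + 1) := rfl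
      have h2 : Nat.primeCounting n = Nat.count Nat.Prime (n + 1) := rfl
      rw [h1, Nat.count_succ, ← h2, Nat.cast_add, ih, Finset.sum_filter, Finset.sum_filter,
        Finset.sum_Ioc_succ_top (Nat.zero_le n)]
      split_ifs <;> simp
  rw [key, key, Finset.sum_filter, Finset.sum_filter,
    Finset.sum_filter, ← Finset.sum_Ioc_consecutive _ (Nat.zero_le a) h]
  ring

theorem theta_diff_le_pi (a b : ℕ) (h : a ≤ b) : Chebyshev.theta b - Chebyshev.theta a ≤
    ((Nat.primeCounting b : ℝ) - Nat.primeCounting a) * Real.log b := by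
  rw [theta_nat_diff a b h, pi_nat_diff a b h, Finset.sum_mul]
  apply Finset.sum_le_sum
  intro p hp
  simp only [Finset.mem_filter, Finset.mem_Ioc] at hp
  rw [one_mul]
  exact Real.log_le_log (by exact_mod_cast hp.2.pos) (by exact_mod_cast hp.1.2)

theorem pi_diff_le_theta (a b : ℕ) (t : ℝ) (h : a ≤ b) (ht0 : 0 < t) (ht : t ≤ a + 1) :
    ((Nat.primeCounting b : ℝ) - Nat.primeCounting a) * Real.log t ≤
    Chebyshev.theta b - Chebyshev.theta a := by
  rw [theta_nat_diff a b h, pi_nat_diff a b h, Finset.sum_mul]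
  apply Finset.sum_le_sum
  intro p hp
  simp only [Finset.mem_filter, Finset.mem_Ioc] at hp
  rw [one_mul]
  apply Real.log_le_log ht0
  have : ((a + 1 : ℕ) : ℝ) ≤ p := by exact_mod_cast hp.1.1
  push_cast at this
  linarith

open Finset ArithmeticFunction in
theorem theta_diff_le_chebS (n : ℕ) :
    Chebyshev.theta n - Chebyshev.theta ((n / 6 : ℕ) : ℝ) ≤ chebS n := by
  rw [theta_nat_diff _ _ (Nat.div_le_self n 6), chebS_eq]
  calc ∑ p ∈ (Ioc (n / 6) n).filter Nat.Prime, Real.log p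
      ≤ ∑ p ∈ (Ioc (n / 6) n).filter Nat.Prime, vonMangoldt p *
    (((n / p : ℕ) : ℝ) - ((n / p / 2 : ℕ) : ℝ) - ((n / p / 3 : ℕ) : ℝ) - ((n / p / 5 : ℕ) : ℝ)
      + ((n / p / 30 : ℕ) : ℝ)) := by
        apply sum_le_sum
        intro p hp
        simp only [mem_filter, mem_Ioc] at hp
        rw [vonMangoldt_apply_prime hp.2]
        apply le_mul_of_one_le_right (Real.log_natCast_nonneg p)
        apply cheb_coeff_ge
        · exact Nat.div_pos hp.1.2 hp.2.pos
        · rw [Nat.div_lt_iff_lt_mul hp.2.pos]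
          omega
    _ ≤ _ := by
        apply sum_le_sum_of_subset_of_nonneg
        · intro p hp
          simp only [mem_filter, mem_Ioc] at hp ⊢
          omega
        · intro p _ _
          exact mul_nonneg vonMangoldt_nonneg (cheb_coeff_nonneg _)

theorem log_fact_upper (n : ℕ) (h : 1 ≤ n) :
    Real.log (Nat.factorial n) ≤ n * Real.log n - n + Real.log n + 1 := by
  induction n, h using Nat.le_induction with
  | base => simp
  | succ n hn ih =>
    rw [Nat.factorial_succ, Nat.cast_mul, Real.log_mul (by positivity) (by positivity)]
    have hn0 : (0 : ℝ) < n := by exact_mod_cast hn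
    have h1 := Real.one_sub_inv_le_log_of_pos (x := ((n : ℝ) + 1) / n) (by positivity)
    rw [Real.log_div (by positivity) (by positivity), inv_div] at h1
    have h2 : ((n : ℝ) + 1) * (1 - n / (n + 1)) ≤
        (n + 1) * (Real.log (n + 1) - Real.log n) := by gcongr
    have h3 : ((n : ℝ) + 1) * (1 - n / (n + 1)) = 1 := by field_simp; ring
    push_cast
    linarith

/-- `t log t - t` is increasing. -/
theorem mul_log_mono (y t : ℝ) (h1 : 1 ≤ y) (h : y ≤ t) :
    y * Real.log y - y ≤ t * Real.log t - t := by
  have h0 : 0 < t := by linarith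
  have h1' : 0 < y := by linarith
  have h2 := Real.one_sub_inv_le_log_of_pos (x := t / y) (by positivity)
  rw [Real.log_div (by positivity) (by positivity), inv_div] at h2
  have h3 : t * (1 - y / t) ≤ t * (Real.log t - Real.log y) := by gcongr
  have h4 : t * (1 - y / t) = t - y := by field_simp
  have h5 : 0 ≤ Real.log y := Real.log_nonneg h1
  nlinarith

theorem log_fact_div_upper (n d : ℕ) (hd : 1 ≤ d) (h : d ≤ n) :
    Real.log (Nat.factorial (n / d)) ≤ ((n : ℝ) / d) * Real.log ((n : ℝ) / d) - (n : ℝ) / d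
      + Real.log ((n : ℝ) / d) + 1 := by
  have h1 : 1 ≤ n / d := Nat.div_pos h hd
  have h2 := log_fact_upper (n / d) h1
  have h3 : ((n / d : ℕ) : ℝ) ≤ (n : ℝ) / d := Nat.cast_div_le
  have h4 : (1 : ℝ) ≤ ((n / d : ℕ) : ℝ) := by exact_mod_cast h1
  have h5 := mul_log_mono _ _ h4 h3
  have h6 := Real.log_le_log (by linarith) h3
  linarith

theorem log_fact_div_lower (n d : ℕ) (hd : 1 ≤ d) (h : d ≤ n) :
    ((n : ℝ) / d) * Real.log ((n : ℝ) / d) - (n : ℝ) / d - Real.log ((n : ℝ) / d)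
      ≤ Real.log (Nat.factorial (n / d)) := by
  have hd0 : (0 : ℝ) < d := by exact_mod_cast hd
  have h3 : (n : ℝ) / d ≤ ((n / d : ℕ) : ℝ) + 1 := (Nat.lt_floor_add_one _).le.trans
    (by rw [Nat.floor_div_eq_div])
  have h1 : 1 ≤ n / d := Nat.div_pos h hd
  have h2 := Stirling.le_log_factorial_stirling (n := n / d + 1) (by omega)
  have hf : Real.log (Nat.factorial (n / d + 1)) =
      Real.log (((n / d : ℕ) : ℝ) + 1) + Real.log (Nat.factorial (n / d)) := by
    rw [Nat.factorial_succ, Nat.cast_mul, Real.log_mul (by positivity) (by positivity)]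
    push_cast
    rfl
  rw [hf, Nat.cast_add, Nat.cast_one] at h2
  have h4 : (1 : ℝ) ≤ (n : ℝ) / d := by
    rw [le_div_iff₀ hd0]; simpa using h
  have h5 := mul_log_mono _ _ h4 h3
  have h6 : ((n / d : ℕ) : ℝ) + 1 ≤ 2 * ((n : ℝ) / d) := by
    have : ((n / d : ℕ) : ℝ) ≤ (n : ℝ) / d := Nat.cast_div_le
    linarith
  have h7 := Real.log_le_log (by positivity) h6
  rw [Real.log_mul (by norm_num) (by positivity)] at h7
  have h8 : Real.log 2 ≤ Real.log (2 * Real.pi) :=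
    Real.log_le_log (by norm_num) (by linarith [Real.pi_gt_three])
  have h9 := Real.log_nonneg h4
  linarith

noncomputable def chebA : ℝ :=
  Real.log 2 / 2 + Real.log 3 / 3 + Real.log 5 / 5 - (Real.log 2 + Real.log 3 + Real.log 5) / 30

theorem chebA_gt : 0.9212 < chebA := by
  unfold chebA
  linarith [Real.log_two_gt_d9, Real.log_three_gt_d9, Real.log_five_gt_d9]

theorem chebA_lt : chebA < 0.9213 := by
  unfold chebA
  linarith [Real.log_two_lt_d9, Real.log_three_lt_d9, Real.log_five_lt_d9]

theorem log_thirty : Real.log 30 = Real.log 2 + Real.log 3 + Real.log 5 := by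
  rw [← Real.log_mul (by norm_num) (by norm_num), ← Real.log_mul (by norm_num) (by norm_num)]
  norm_num

theorem chebS_bounds (n : ℕ) (h : 30 ≤ n) :
    chebA * n - 5 * Real.log n ≤ chebS n ∧ chebS n ≤ chebA * n + 5 * Real.log n := by
  have hn : (0 : ℝ) < n := by exact_mod_cast (by omega : 0 < n)
  have u1 := log_fact_div_upper n 1 (by omega) (by omega)
  have u2 := log_fact_div_upper n 2 (by omega) (by omega)
  have u3 := log_fact_div_upper n 3 (by omega) (by omega)
  have u5 := log_fact_div_upper n 5 (by omega) (by omega)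
  have u30 := log_fact_div_upper n 30 (by omega) (by omega)
  have l1 := log_fact_div_lower n 1 (by omega) (by omega)
  have l2 := log_fact_div_lower n 2 (by omega) (by omega)
  have l3 := log_fact_div_lower n 3 (by omega) (by omega)
  have l5 := log_fact_div_lower n 5 (by omega) (by omega)
  have l30 := log_fact_div_lower n 30 (by omega) (by omega)
  push_cast at u1 u2 u3 u5 u30 l1 l2 l3 l5 l30
  rw [Real.log_div hn.ne' (by norm_num)] at u1 u2 u3 u5 u30 l1 l2 l3 l5 l30
  rw [log_thirty] at u30 l30
  rw [Nat.div_one, Real.log_one] at u1 l1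
  have g2 := Real.log_two_gt_d9
  have g3 := Real.log_three_gt_d9
  have g5 := Real.log_five_gt_d9
  unfold chebS chebA
  constructor <;> nlinarith

theorem theta_step (n : ℕ) (h : 30 ≤ n) :
    Chebyshev.theta n - Chebyshev.theta ((n / 6 : ℕ) : ℝ) ≤ chebA * n + 5 * Real.log n :=
  (theta_diff_le_chebS n).trans (chebS_bounds n h).2

/-- One descent step, uniform version. -/
theorem theta_pi_step (x d : ℕ) (k : ℝ) (hd : 1 ≤ d) (hx : 30 * d ≤ x) (hk : 0 ≤ k)
    (hlog : Real.log (3 * x) ≤ k * (Real.log x - Real.log (d * 6))) :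
    Chebyshev.theta ((x / d : ℕ) : ℝ) - Chebyshev.theta ((x / (d * 6) : ℕ) : ℝ)
      ≤ chebA * (x / d) + 5 * Real.log x ∧
    ((Nat.primeCounting (x / d) : ℝ) - Nat.primeCounting (x / (d * 6))) * Real.log (3 * x)
      ≤ k * (chebA * (x / d) + 5 * Real.log x) := by
  have hx0 : (0 : ℝ) < x := by exact_mod_cast (by omega : 0 < x)
  have hd0 : (0 : ℝ) < d := by exact_mod_cast hd
  have hxd : 30 ≤ x / d := by rw [Nat.le_div_iff_mul_le hd]; exact hx
  have h1 := theta_step (x / d) hxd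
  rw [Nat.div_div_eq_div_mul] at h1
  have h2 : ((x / d : ℕ) : ℝ) ≤ (x : ℝ) / d := Nat.cast_div_le
  have h3 : Real.log ((x / d : ℕ) : ℝ) ≤ Real.log x :=
    Real.log_le_log (by exact_mod_cast (by omega : 0 < x / d))
      (by exact_mod_cast Nat.div_le_self x d)
  have hA := chebA_gt
  have h4 : chebA * ((x / d : ℕ) : ℝ) ≤ chebA * ((x : ℝ) / d) := by gcongr
  have h5 : Chebyshev.theta ((x / d : ℕ) : ℝ) - Chebyshev.theta ((x / (d * 6) : ℕ) : ℝ)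
      ≤ chebA * (x / d) + 5 * Real.log x := by linarith
  refine ⟨h5, ?_⟩
  have hle : x / (d * 6) ≤ x / d := Nat.div_le_div_left (by omega) hd
  have h6 : (x : ℝ) / ((d * 6 : ℕ) : ℝ) ≤ ((x / (d * 6) : ℕ) : ℝ) + 1 :=
    (Nat.lt_floor_add_one _).le.trans (by rw [Nat.floor_div_eq_div])
  have h7 := pi_diff_le_theta (x / (d * 6)) (x / d) ((x : ℝ) / ((d * 6 : ℕ) : ℝ)) hle
    (by push_cast; positivity) h6
  rw [Real.log_div hx0.ne' (by push_cast; positivity)] at h7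
  push_cast at h7
  have h8 : (0 : ℝ) ≤ (Nat.primeCounting (x / d) : ℝ) - Nat.primeCounting (x / (d * 6)) := by
    have : (Nat.primeCounting (x / (d * 6)) : ℝ) ≤ Nat.primeCounting (x / d) := by
      exact_mod_cast Nat.monotone_primeCounting hle
    linarith
  calc _ ≤ ((Nat.primeCounting (x / d) : ℝ) - Nat.primeCounting (x / (d * 6))) *
        (k * (Real.log x - Real.log (d * 6))) := by gcongr
    _ = k * (((Nat.primeCounting (x / d) : ℝ) - Nat.primeCounting (x / (d * 6))) *
        (Real.log x - Real.log (d * 6))) := by ring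
    _ ≤ _ := by gcongr; linarith

/-- `log X ≤ c √X` beyond a given point. -/
theorem log_sqrt_bound (X : ℝ) (h : 786432 ≤ X) : Real.log X ≤ 0.0155 * Real.sqrt X := by
  have hs : (880 : ℝ) ≤ Real.sqrt X := Real.le_sqrt_of_sq_le (by linarith)
  have hX : Real.log X = 2 * Real.log (Real.sqrt X) := by
    rw [Real.log_sqrt (by linarith)]; ring
  have h1 := Real.log_le_sub_one_of_pos (x := Real.sqrt X / 880) (by positivity)
  rw [Real.log_div (by positivity) (by norm_num)] at h1
  have h2 : Real.log 880 ≤ 6.81 := by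
    have : Real.log 880 ≤ Real.log (2 ^ 4 * 5 * 3 ^ 2 * (5 / 4)) :=
      Real.log_le_log (by norm_num) (by norm_num)
    rw [Real.log_mul (by norm_num) (by norm_num), Real.log_mul (by norm_num) (by norm_num),
      Real.log_mul (by norm_num) (by norm_num), Real.log_div (by norm_num) (by norm_num),
      show (4 : ℝ) = 2 ^ 2 by norm_num, Real.log_pow, Real.log_pow, Real.log_pow] at this
    push_cast at this
    linarith [Real.log_two_gt_d9, Real.log_three_lt_d9, Real.log_five_lt_d9, Real.log_two_lt_d9]
  linarith

theorem final_arith (x A L M T0 T1 T2 T3 T4 P0 P1 P2 P3 P4 P S U : ℝ) {V : ℝ}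
    (t1 : T0 - T1 ≤ A * (x / 1) + 5 * L)
    (t2 : T1 - T2 ≤ A * (x / 6) + 5 * L)
    (t3 : T2 - T3 ≤ A * (x / 36) + 5 * L)
    (t4 : T3 - T4 ≤ A * (x / 216) + 5 * L)
    (p1 : (P0 - P1) * M ≤ 32 / 25 * (A * (x / 1) + 5 * L))
    (p2 : (P1 - P2) * M ≤ 77 / 50 * (A * (x / 6) + 5 * L))
    (p3 : (P2 - P3) * M ≤ 193 / 100 * (A * (x / 36) + 5 * L))
    (p4 : (P3 - P4) * M ≤ 129 / 50 * (A * (x / 216) + 5 * L))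
    (t5 : T4 ≤ 1.4 * (x / 1296))
    (q : 64 * P4 * M ≤ P0 * M)
    (hE : V - U ≤ 0.031 * (3 * x))
    (hM : M ≤ 0.00002 * (3 * x))
    (hL : L ≤ 0.00006 * x)
    (lo1 : A * (3 * x) - 5 * M ≤ S)
    (lo2 : S ≤ V)
    (lo3 : U - T0 ≤ (P - P0) * M)
    (c1 : 0.9212 * x ≤ A * x) (c2 : A * x ≤ 0.9213 * x) :
    0 ≤ (P - 2 * P0) * M := by
  have e : ∀ c : ℝ, A * (x / c) = A * x / c := fun c => by ring
  rw [e] at t1 t2 t3 t4 p1 p2 p3 p4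
  rw [show A * (3 * x) = 3 * (A * x) by ring] at lo1
  rw [sub_mul] at p1 p2 p3 p4 lo3 ⊢
  rw [mul_assoc] at q ⊢
  generalize A * x = Z at *
  generalize P0 * M = R0 at *
  generalize P1 * M = R1 at *
  generalize P2 * M = R2 at *
  generalize P3 * M = R3 at *
  generalize P4 * M = R4 at *
  generalize P * M = R at *
  have hx : 0 ≤ x := by linarith
  have lower : 1.55 * x ≤ R - R0 := by linarith
  have upper : R0 ≤ 1.55 * x := by linarith
  linarith

theorem pi_large (x : ℕ) (hx : 262144 ≤ x)
    (ih : ∀ y < x, 2 * Nat.primeCounting y ≤ Nat.primeCounting (3 * y)) :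
    2 * Nat.primeCounting x ≤ Nat.primeCounting (3 * x) := by
  have hxr : (262144 : ℝ) ≤ x := by exact_mod_cast hx
  have hx0 : (0 : ℝ) < x := by linarith
  have a2 := Real.log_two_gt_d9
  have a3 := Real.log_three_gt_d9
  have b2 := Real.log_two_lt_d9
  have b3 := Real.log_three_lt_d9
  have hL : 18 * Real.log 2 ≤ Real.log x := by
    have : Real.log ((2 : ℝ) ^ 18) ≤ Real.log x := Real.log_le_log (by norm_num) (by linarith)
    rw [Real.log_pow] at this
    exact_mod_cast this
  have hM : Real.log (3 * x) = Real.log 3 + Real.log x :=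
    Real.log_mul (by norm_num) hx0.ne'
  have h6 : Real.log 6 = Real.log 2 + Real.log 3 := by
    rw [← Real.log_mul (by norm_num) (by norm_num)]; norm_num
  have h36 : Real.log 36 = 2 * (Real.log 2 + Real.log 3) := by
    rw [← h6, show (36 : ℝ) = 6 ^ 2 by norm_num, Real.log_pow]; norm_num
  have h216 : Real.log 216 = 3 * (Real.log 2 + Real.log 3) := by
    rw [← h6, show (216 : ℝ) = 6 ^ 3 by norm_num, Real.log_pow]; norm_num
  have h1296 : Real.log 1296 = 4 * (Real.log 2 + Real.log 3) := by
    rw [← h6, show (1296 : ℝ) = 6 ^ 4 by norm_num, Real.log_pow]; norm_num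
  obtain ⟨t1, p1⟩ := theta_pi_step x 1 1.28 (by omega) (by omega) (by norm_num)
    (by norm_num [h6]; rw [hM]; linarith)
  obtain ⟨t2, p2⟩ := theta_pi_step x 6 1.54 (by omega) (by omega) (by norm_num)
    (by norm_num [h36]; rw [hM]; linarith)
  obtain ⟨t3, p3⟩ := theta_pi_step x 36 1.93 (by omega) (by omega) (by norm_num)
    (by norm_num [h216]; rw [hM]; linarith)
  obtain ⟨t4, p4⟩ := theta_pi_step x 216 2.58 (by omega) (by omega) (by norm_num)
    (by norm_num [h1296]; rw [hM]; linarith)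
  norm_num only [Nat.div_one] at t1 t2 t3 t4 p1 p2 p3 p4
  have hA := chebA_gt
  have hA' := chebA_lt
  -- the tail of theta
  have t5 := Chebyshev.theta_le_log4_mul_x (x := ((x / 1296 : ℕ) : ℝ)) (by positivity)
  have t6 : ((x / 1296 : ℕ) : ℝ) ≤ (x : ℝ) / 1296 := by
    have : ((x / 1296 : ℕ) : ℝ) ≤ (x : ℝ) / ((1296 : ℕ) : ℝ) := Nat.cast_div_le
    exact_mod_cast this
  have hl4 : Real.log 4 = 2 * Real.log 2 := by
    rw [show (4 : ℝ) = 2 ^ 2 by norm_num, Real.log_pow]; norm_num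
  have t7 : Real.log 4 * ((x / 1296 : ℕ) : ℝ) ≤ 1.4 * ((x : ℝ) / 1296) := by
    gcongr
    linarith
  -- the tail of pi, by induction
  have q1 := ih (x / 1296) (by omega)
  have q2 := ih (3 * (x / 1296)) (by omega)
  have q3 := ih (3 * (3 * (x / 1296))) (by omega)
  have q4 := ih (3 * (3 * (3 * (x / 1296)))) (by omega)
  have q5 := ih (3 * (3 * (3 * (3 * (x / 1296))))) (by omega)
  have q6 := ih (3 * (3 * (3 * (3 * (3 * (x / 1296)))))) (by omega)
  have q7 := Nat.monotone_primeCounting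
    (show 3 * (3 * (3 * (3 * (3 * (3 * (x / 1296)))))) ≤ x by omega)
  have q8 : 64 * Nat.primeCounting (x / 1296) ≤ Nat.primeCounting x := by omega
  have q9 : 64 * (Nat.primeCounting (x / 1296) : ℝ) ≤ Nat.primeCounting x := by exact_mod_cast q8
  -- lower bound
  have hX : (786432 : ℝ) ≤ 3 * (x : ℝ) := by linarith
  have hlog := log_sqrt_bound (3 * x) hX
  have hss : Real.sqrt (3 * x) * Real.sqrt (3 * x) = 3 * x := Real.mul_self_sqrt (by linarith)
  have hs : (880 : ℝ) ≤ Real.sqrt (3 * x) := Real.le_sqrt_of_sq_le (by linarith)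
  have hE := Chebyshev.psi_sub_theta_le (x := 3 * (x : ℝ)) (by linarith)
  have hE2 : 2 * Real.sqrt (3 * x) * Real.log (3 * x) ≤ 0.031 * (3 * x) := by
    have : 2 * Real.sqrt (3 * x) * Real.log (3 * x) ≤
      2 * Real.sqrt (3 * x) * (0.0155 * Real.sqrt (3 * x)) := by gcongr
    linarith
  have hlx : Real.log (3 * x) ≤ 0.00002 * (3 * x) := by
    nlinarith
  have hlx' : Real.log x ≤ 0.00006 * x := by linarith
  have lo1 := (chebS_bounds (3 * x) (by omega)).1
  have lo2 := chebS_le_psi (3 * x)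
  push_cast at lo1 lo2
  have lo3 := theta_diff_le_pi x (3 * x) (by omega)
  push_cast at lo3
  have hM0 : 0 < Real.log (3 * x) := by rw [hM]; linarith
  have fin : 0 ≤ ((Nat.primeCounting (3 * x) : ℝ) - 2 * Nat.primeCounting x)
      * Real.log (3 * x) := by
    have q10 : 64 * (Nat.primeCounting (x / 1296) : ℝ) * Real.log (3 * x) ≤
        Nat.primeCounting x * Real.log (3 * x) := by gcongr
    have c1 : 0.9212 * (x : ℝ) ≤ chebA * x := by gcongr
    have c2 : chebA * (x : ℝ) ≤ 0.9213 * x := by gcongr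
    exact final_arith _ _ _ _ _ _ _ _ _ _ _ _ _ _ _ _ _ t1 t2 t3 t4 p1 p2 p3 p4 (t5.trans t7)
      q10 (hE.trans hE2) hlx hlx' lo1 lo2 lo3 c1 c2
  have := nonneg_of_mul_nonneg_left fin hM0
  have h : (2 * Nat.primeCounting x : ℝ) ≤ Nat.primeCounting (3 * x) := by linarith
  exact_mod_cast h

theorem pi_three_mul (x : ℕ) : 2 * Nat.primeCounting x ≤ Nat.primeCounting (3 * x) := by
  induction x using Nat.strong_induction_on with
  | _ x ih =>
    rcases Nat.lt_or_ge x 32 with h | h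
    · exact tiny_range x h
    rcases Nat.lt_or_ge x 262144 with h' | h'
    · exact pi_small_range x h h'.le
    · exact pi_large x h' ih

theorem nthPrime_two_mul_le (b : ℕ) (hb : 1 ≤ b) :
    nthPrime (2 * b) ≤ 3 * nthPrime b := by
  unfold nthPrime
  have h1 : Nat.primeCounting (Nat.nth Nat.Prime (b - 1)) = b := by
    have h2 : Nat.primeCounting (Nat.nth Nat.Prime (b - 1)) =
      Nat.count Nat.Prime (Nat.nth Nat.Prime (b - 1) + 1) := rfl
    rw [h2, Nat.count_nth_succ_of_infinite Nat.infinite_setOf_prime]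
    omega
  have h3 := pi_three_mul (Nat.nth Nat.Prime (b - 1))
  rw [h1] at h3
  have h4 : Nat.primeCounting (3 * Nat.nth Nat.Prime (b - 1)) =
      Nat.count Nat.Prime (3 * Nat.nth Nat.Prime (b - 1) + 1) := rfl
  have := Nat.nth_lt_of_lt_count (p := Nat.Prime) (n := 3 * Nat.nth Nat.Prime (b - 1) + 1)
    (k := 2 * b - 1) (by omega)
  omega
end
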